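/- arXiv:2301.05649 — 3 statements merged into one kernel-verified Lean document; each statement's English description precedes it below -/
import Mathlib

section
/- A consideration filter Γ on X satisfies Independence of Others (IO) if and only if there exists a subset Y of X such that Γ(A) = A ∩ Y for every subset A of X. -/
/-- Γ satisfies IO iff there exists Y ⊆ X with Γ(A) = A ∩ Y for every menu A. -/
theorem IO_iff_intersection_rep {X : Type*} (Γ : Set X → Set X)
    (hΓ : ∀ A : Set X, Γ A ⊆ A) :
    (∀ x : X, (∀ A : Set X, x ∈ A → x ∈ Γ A) ∨ (∀ A : Set X, x ∉ Γ A)) ↔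
    (∃ Y : Set X, ∀ A : Set X, Γ A = A ∩ Y) := by
  constructor
  · intro h
    refine ⟨{x | ∀ A : Set X, x ∈ A → x ∈ Γ A}, fun A => Set.Subset.antisymm ?_ ?_⟩
    · intro x hx
      exact ⟨hΓ A hx, (h x).resolve_right fun hn => hn A hx⟩
    · rintro x ⟨hxA, hx⟩
      exact hx A hxA
  · rintro ⟨Y, hY⟩ x
    by_cases hx : x ∈ Y
    · left
      intro A hA
      rw [hY]
      exact ⟨hA, hx⟩
    · right
      intro A hA
      rw [hY] at hA
      exact hx hA.2
end

section
/- A consideration filter Γ on X satisfies Independence of Others (IO) if and only if there exist a real number k* and a function u₁ : X → ℝ such that Γ(A) = {x ∈ A : u₁(x) ≥ k*} for every subset A of X. -/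
/-- Theorem 6: Γ satisfies IO iff it admits a threshold representation:
there exist k* ∈ ℝ and u₁ : X → ℝ with Γ(A) = {x ∈ A : u₁(x) ≥ k*}. -/
theorem IO_iff_threshold_rep {X : Type*} (Γ : Set X → Set X)
    (hΓ : ∀ A : Set X, Γ A ⊆ A) :
    (∀ x : X, (∀ A : Set X, x ∈ A → x ∈ Γ A) ∨ (∀ A : Set X, x ∉ Γ A)) ↔
    (∃ (kstar : ℝ) (u₁ : X → ℝ), ∀ A : Set X, Γ A = {x ∈ A | u₁ x ≥ kstar}) := by
  constructor
  · intro h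
    refine ⟨1, Set.indicator {x | x ∈ Γ {x}} 1, fun A => ?_⟩
    ext x
    by_cases hx : x ∈ Γ {x}
    · have hall := (h x).resolve_right fun hn => hn _ hx
      simpa [Set.indicator, hx] using ⟨fun hA => hΓ A hA, hall A⟩
    · have hnone := (h x).resolve_left fun hy => hx (hy _ rfl)
      simp [Set.indicator, hx, hnone A]
  · rintro ⟨k, u, h⟩ x
    by_cases hx : u x ≥ k
    · exact Or.inl fun A hA => by rw [h]; exact ⟨hA, hx⟩
    · exact Or.inr fun A hA => by rw [h] at hA; exact hx hA.2
end

section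
/- If a consideration filter Γ on X satisfies Sen's α and Condition τ, then, defining Y = {x ∈ X : x ∈ Γ(A) for some subset A of X}, one has Γ(A) = A ∩ Y for every subset A of X. -/
/-- If Γ satisfies Sen's α and Condition τ then, with
Y = {x : x ∈ Γ(A) for some A}, one has Γ(A) = A ∩ Y for every menu A. -/
theorem alpha_tau_intersection_rep {X : Type*} (Γ : Set X → Set X)
    (hΓ : ∀ A : Set X, Γ A ⊆ A)
    (hα : ∀ A B : Set X, A ⊆ B → ∀ x ∈ A, x ∈ Γ B → x ∈ Γ A)
    (hτ : ∀ A B : Set X, A ⊆ B → ∀ x, x ∈ Γ A → x ∈ Γ B) :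
    ∀ A : Set X, Γ A = A ∩ {x : X | ∃ B : Set X, x ∈ Γ B} := by
  intro A
  ext x
  constructor
  · exact fun hx => ⟨hΓ A hx, A, hx⟩
  · rintro ⟨hxA, B, hxB⟩
    exact hα A Set.univ (Set.subset_univ A) x hxA (hτ B Set.univ (Set.subset_univ B) x hxB)
end
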